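/- The index set EXL* = {e : e codes a u.c.e. family that is TxtEx*-learnable by some learner} is a Σ⁰₅ set, i.e., membership in EXL* is definable by a Σ⁰₅ predicate. -/

import Mathlib

/-- `Wset e` is the `e`-th computably enumerable set: the domain of the `e`-th
partial computable function in the standard numbering by codes. -/
def Wset (e : ℕ) : Set ℕ :=
  {x | ((Denumerable.ofNat Nat.Partrec.Code e).eval x).Dom}

/-- The `i`-th column `{x : ⟨i,x⟩ ∈ W_a}` of the c.e. set coded by `a`;
the number `a` codes the u.c.e. family whose members are its columns. -/
def column (a i : ℕ) : Set ℕ := {x | Nat.pair i x ∈ Wset a}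

/-- The initial segment of length `n` of an enumeration `f`. -/
def initSeg (f : ℕ → ℕ) (n : ℕ) : List ℕ := (List.range n).map f

/-- The `m`-th computable learner in the standard effective enumeration of all
partial computable functions from finite sequences to ℕ. -/
def learnerOfCode (m : ℕ) : List ℕ →. ℕ :=
  fun σ => (Denumerable.ofNat Nat.Partrec.Code m).eval (Encodable.encode σ)

/-- `M` TxtFin-identifies the enumeration `f` (here `Option.none` plays the
role of the symbol `?`). -/
def TxtFinIdentifies (M : List ℕ →. Option ℕ) (f : ℕ → ℕ) : Prop :=
  ∃ n h, (∀ n' < n, M (initSeg f n') = Part.some Option.none) ∧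
    M (initSeg f n) = Part.some (Option.some h) ∧ Wset h = Set.range f

/-- `M` TxtFin-learns the set `S`. -/
def TxtFinLearnsSet (M : List ℕ →. Option ℕ) (S : Set ℕ) : Prop :=
  ∀ f : ℕ → ℕ, Set.range f = S → TxtFinIdentifies M f

/-- `M` TxtEx-identifies the enumeration `f`. -/
def TxtExIdentifies (M : List ℕ →. ℕ) (f : ℕ → ℕ) : Prop :=
  ∃ n, (∃ N, ∀ i ≥ N, M (initSeg f i) = Part.some n) ∧ Wset n = Set.range f

/-- `M` TxtEx-learns the set `S`. -/
def TxtExLearnsSet (M : List ℕ →. ℕ) (S : Set ℕ) : Prop :=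
  ∀ f : ℕ → ℕ, Set.range f = S → TxtExIdentifies M f

/-- `M` TxtBC-identifies the enumeration `f`. -/
def TxtBCIdentifies (M : List ℕ →. ℕ) (f : ℕ → ℕ) : Prop :=
  ∃ N, ∀ i ≥ N, ∃ h, M (initSeg f i) = Part.some h ∧ Wset h = Set.range f

/-- `M` TxtBC-learns the set `S`. -/
def TxtBCLearnsSet (M : List ℕ →. ℕ) (S : Set ℕ) : Prop :=
  ∀ f : ℕ → ℕ, Set.range f = S → TxtBCIdentifies M f

/-- `M` TxtEx*-identifies the enumeration `f`. -/
def TxtExStarIdentifies (M : List ℕ →. ℕ) (f : ℕ → ℕ) : Prop :=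
  ∃ n, (∃ N, ∀ i ≥ N, M (initSeg f i) = Part.some n) ∧
    (symmDiff (Wset n) (Set.range f)).Finite

/-- `M` TxtEx*-learns the set `S`. -/
def TxtExStarLearnsSet (M : List ℕ →. ℕ) (S : Set ℕ) : Prop :=
  ∀ f : ℕ → ℕ, Set.range f = S → TxtExStarIdentifies M f

/-- Indices of cofinite c.e. sets. -/
def COF : Set ℕ := {e | (Wset e)ᶜ.Finite}

/-- Indices of coinfinite c.e. sets. -/
def COINF : Set ℕ := {e | (Wset e)ᶜ.Infinite}

/-- `P` is Σ⁰₃: definable by `∃∀∃` over a computable relation. -/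
def IsSigma3 (P : Set ℕ) : Prop :=
  ∃ R : ℕ → ℕ → ℕ → ℕ → Bool,
    Computable (fun p : ℕ × ℕ × ℕ × ℕ => R p.1 p.2.1 p.2.2.1 p.2.2.2) ∧
    ∀ e, e ∈ P ↔ ∃ x, ∀ y, ∃ z, R e x y z = true

/-- `P` is Σ⁰₄: definable by `∃∀∃∀` over a computable relation. -/
def IsSigma4 (P : Set ℕ) : Prop :=
  ∃ R : ℕ → ℕ → ℕ → ℕ → ℕ → Bool,
    Computable (fun p : ℕ × ℕ × ℕ × ℕ × ℕ =>
      R p.1 p.2.1 p.2.2.1 p.2.2.2.1 p.2.2.2.2) ∧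
    ∀ e, e ∈ P ↔ ∃ x, ∀ y, ∃ z, ∀ w, R e x y z w = true

/-- `P` is Σ⁰₅: definable by `∃∀∃∀∃` over a computable relation. -/
def IsSigma5 (P : Set ℕ) : Prop :=
  ∃ R : ℕ → ℕ → ℕ → ℕ → ℕ → ℕ → Bool,
    Computable (fun p : ℕ × ℕ × ℕ × ℕ × ℕ × ℕ =>
      R p.1 p.2.1 p.2.2.1 p.2.2.2.1 p.2.2.2.2.1 p.2.2.2.2.2) ∧
    ∀ e, e ∈ P ↔ ∃ x, ∀ y, ∃ z, ∀ w, ∃ v, R e x y z w v = true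

/-- `f : ℕ → ℕ` is Δ⁰₂: the pointwise limit of a computable function. -/
def IsDelta2Fun (f : ℕ → ℕ) : Prop :=
  ∃ g : ℕ → ℕ → ℕ, Computable₂ g ∧ ∀ x, ∃ s₀, ∀ s ≥ s₀, g s x = f x

/-- The index set of codes of TxtEx*-learnable u.c.e. families. -/
def EXLstar : Set ℕ :=
  {e | ∃ M : List ℕ →. ℕ, Partrec M ∧ ∀ i, TxtExStarLearnsSet M (column e i)}

/-! ### The arithmetical hierarchy over primitive recursive predicates -/

/-- `SigmaPred n p` says that `p` is `Σ⁰ₙ`, built over a primitive recursive matrix. -/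
def SigmaPred : ℕ → ∀ {α : Type} [Primcodable α], (α → Prop) → Prop
  | 0, _, _, p => PrimrecPred p
  | n + 1, α, _, p => ∃ q : α × ℕ → Prop, SigmaPred n (fun c => ¬ q c) ∧
      ∀ a, p a ↔ ∃ x, q (a, x)

namespace SigmaPred

variable {α β : Type} [Primcodable α] [Primcodable β]

theorem of_iff {n : ℕ} {p q : α → Prop} (hp : SigmaPred n p) (h : ∀ a, p a ↔ q a) :
    SigmaPred n q := by
  have : p = q := funext fun a => propext (h a)
  exact this ▸ hp

theorem comp {n : ℕ} {p : β → Prop} (hp : SigmaPred n p) {f : α → β} (hf : Primrec f) :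
    SigmaPred n (fun a => p (f a)) := by
  induction n generalizing α β with
  | zero => exact PrimrecPred.comp hp hf
  | succ n ih =>
    obtain ⟨q, hq, h⟩ := hp
    exact ⟨fun c => q (f c.1, c.2),
      ih hq (f := fun c : α × ℕ => (f c.1, c.2))
        (Primrec.pair (hf.comp Primrec.fst) Primrec.snd),
      fun a => h (f a)⟩

theorem not_succ {n : ℕ} {p : α → Prop} (hp : SigmaPred n p) :
    SigmaPred (n + 1) (fun a => ¬ p a) :=
  ⟨fun c => ¬ p c.1, (hp.comp Primrec.fst).of_iff fun _ => not_not.symm, fun a => by simp⟩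

theorem succ {n : ℕ} {p : α → Prop} (hp : SigmaPred n p) : SigmaPred (n + 1) p := by
  induction n generalizing α with
  | zero =>
    exact (not_succ (n := 0) (PrimrecPred.not hp)).of_iff fun _ => not_not
  | succ n ih =>
    obtain ⟨q, hq, h⟩ := hp
    exact ⟨q, ih hq, h⟩

theorem and_or {n : ℕ} {p q : α → Prop} (hp : SigmaPred n p) (hq : SigmaPred n q) :
    SigmaPred n (fun a => p a ∧ q a) ∧ SigmaPred n (fun a => p a ∨ q a) := by
  induction n generalizing α with
  | zero => exact ⟨PrimrecPred.and hp hq, PrimrecPred.or hp hq⟩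
  | succ n ih =>
    obtain ⟨p', hp', h⟩ := hp
    obtain ⟨q', hq', h'⟩ := hq
    constructor
    · have hl : Primrec fun c : α × ℕ => (c.1, c.2.unpair.1) :=
        Primrec.pair Primrec.fst (Primrec.fst.comp (Primrec.unpair.comp Primrec.snd))
      have hr : Primrec fun c : α × ℕ => (c.1, c.2.unpair.2) :=
        Primrec.pair Primrec.fst (Primrec.snd.comp (Primrec.unpair.comp Primrec.snd))
      refine ⟨fun c => p' (c.1, c.2.unpair.1) ∧ q' (c.1, c.2.unpair.2),
        (ih (hp'.comp hl) (hq'.comp hr)).2.of_iff fun _ => not_and_or.symm, fun a => ?_⟩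
      simp only [h, h']
      constructor
      · rintro ⟨⟨x, hx⟩, y, hy⟩
        exact ⟨Nat.pair x y, by simpa using ⟨hx, hy⟩⟩
      · rintro ⟨z, hx, hy⟩
        exact ⟨⟨_, hx⟩, _, hy⟩
    · refine ⟨fun c => p' c ∨ q' c, (ih hp' hq').1.of_iff fun _ => not_or.symm, fun a => ?_⟩
      simp only [h, h', exists_or]

theorem and {n : ℕ} {p q : α → Prop} (hp : SigmaPred n p) (hq : SigmaPred n q) :
    SigmaPred n (fun a => p a ∧ q a) := (and_or hp hq).1

theorem or {n : ℕ} {p q : α → Prop} (hp : SigmaPred n p) (hq : SigmaPred n q) :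
    SigmaPred n (fun a => p a ∨ q a) := (and_or hp hq).2

theorem exists_nat {n : ℕ} {p : α × ℕ → Prop} (hp : SigmaPred (n + 1) p) :
    SigmaPred (n + 1) (fun a => ∃ x, p (a, x)) := by
  obtain ⟨q, hq, h⟩ := hp
  have hf : Primrec fun c : α × ℕ => ((c.1, c.2.unpair.1), c.2.unpair.2) :=
    Primrec.pair (Primrec.pair Primrec.fst (Primrec.fst.comp (Primrec.unpair.comp Primrec.snd)))
      (Primrec.snd.comp (Primrec.unpair.comp Primrec.snd))
  refine ⟨fun c => q ((c.1, c.2.unpair.1), c.2.unpair.2), hq.comp hf, fun a => ?_⟩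
  simp only [h]
  constructor
  · rintro ⟨x, y, hy⟩
    exact ⟨Nat.pair x y, by simpa using hy⟩
  · rintro ⟨z, hz⟩
    exact ⟨_, _, hz⟩

theorem exists' [Inhabited β] {n : ℕ} {p : α → β → Prop}
    (hp : SigmaPred (n + 1) (fun c : α × β => p c.1 c.2)) :
    SigmaPred (n + 1) (fun a => ∃ b, p a b) := by
  have hf : Primrec fun c : α × ℕ => (c.1, ((Encodable.decode c.2 : Option β).getD default)) :=
    Primrec.pair Primrec.fst
      (Primrec.option_getD_default.comp (Primrec.decode.comp Primrec.snd))
  refine (hp.comp hf).exists_nat.of_iff fun a => ?_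
  constructor
  · rintro ⟨x, hx⟩
    exact ⟨_, hx⟩
  · rintro ⟨b, hb⟩
    exact ⟨Encodable.encode b, by simpa using hb⟩

/-- A universal quantifier in front of a `Σ⁰ₙ` predicate costs one level: the negation is
`Σ⁰ₙ₊₁`. -/
theorem not_forall' [Inhabited β] {n : ℕ} {p : α → β → Prop}
    (hp : SigmaPred n (fun c : α × β => p c.1 c.2)) :
    SigmaPred (n + 1) (fun a => ¬ ∀ b, p a b) :=
  (exists' (p := fun a b => ¬ p a b) hp.not_succ).of_iff fun _ => not_forall.symm

theorem isSigma5 {P : Set ℕ} (hP : SigmaPred 5 (fun e => e ∈ P)) : IsSigma5 P := by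
  obtain ⟨q₁, ⟨q₂, ⟨q₃, ⟨q₄, ⟨q₅, ⟨hd, hq⟩, h₅⟩, h₄⟩, h₃⟩, h₂⟩, h₁⟩ := hP
  have hassoc : Computable fun p : ℕ × ℕ × ℕ × ℕ × ℕ × ℕ =>
      (((((p.1, p.2.1), p.2.2.1), p.2.2.2.1), p.2.2.2.2.1), p.2.2.2.2.2) := by
    refine Primrec.to_comp ?_
    have h1 := @Primrec.fst ℕ (ℕ × ℕ × ℕ × ℕ × ℕ) _ _
    have h2 := @Primrec.snd ℕ (ℕ × ℕ × ℕ × ℕ × ℕ) _ _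
    exact .pair (.pair (.pair (.pair (.pair h1 (Primrec.fst.comp h2))
      (Primrec.fst.comp (Primrec.snd.comp h2)))
      (Primrec.fst.comp (Primrec.snd.comp (Primrec.snd.comp h2))))
      (Primrec.fst.comp (Primrec.snd.comp (Primrec.snd.comp (Primrec.snd.comp h2)))))
      (Primrec.snd.comp (Primrec.snd.comp (Primrec.snd.comp (Primrec.snd.comp h2))))
  refine ⟨fun e x y z w v => !(@decide _ (hd (((((e, x), y), z), w), v))),
    Primrec.not.to_comp.comp (hq.to_comp.comp hassoc), fun e => ?_⟩
  refine (h₁ e).trans (exists_congr fun x => not_iff_not.1 ((h₂ _).trans ?_))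
  rw [not_forall]
  refine exists_congr fun y => not_iff_not.1 ((h₃ _).trans ?_)
  rw [not_not]
  refine exists_congr fun z => not_iff_not.1 ((h₄ _).trans ?_)
  rw [not_forall]
  refine exists_congr fun w => not_iff_not.1 ((h₅ _).trans ?_)
  rw [not_not]
  refine exists_congr fun v => ?_
  simp

end SigmaPred

/-! ### Texts and stabilizing sequences -/

open Filter

theorem mem_initSeg {f : ℕ → ℕ} {n x : ℕ} : x ∈ initSeg f n ↔ ∃ i < n, f i = x := by
  simp [initSeg]

theorem length_initSeg (f : ℕ → ℕ) (n : ℕ) : (initSeg f n).length = n := by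
  simp [initSeg]

theorem take_initSeg (f : ℕ → ℕ) {k n : ℕ} (h : k ≤ n) :
    (initSeg f n).take k = initSeg f k := by
  simp [initSeg, ← List.map_take, List.take_range, min_eq_left h]

theorem eventually_subset_initSeg {f : ℕ → ℕ} {σ : List ℕ} (h : ∀ x ∈ σ, x ∈ Set.range f) :
    ∀ᶠ i in atTop, ∀ x ∈ σ, x ∈ initSeg f i := by
  have := (eventually_all_finset (l := atTop) σ.toFinset
    (p := fun x i => x ∈ initSeg f i)).2 fun x hx => by
      obtain ⟨j, rfl⟩ := h x (List.mem_toFinset.1 hx)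
      filter_upwards [eventually_gt_atTop j] with i hi
      exact mem_initSeg.2 ⟨j, hi, rfl⟩
  filter_upwards [this] with i hi x hx
  exact hi x (List.mem_toFinset.2 hx)

theorem exists_initSeg_eq {S : ℕ → List ℕ} (hS : ∀ n, S n <+: S (n + 1))
    (hlen : ∀ n, n ≤ (S n).length) : ∃ f, ∀ n, initSeg f (S n).length = S n := by
  have hmono : ∀ {m n}, m ≤ n → S m <+: S n := fun {m n} h => by
    induction h with
    | refl => exact List.prefix_rfl
    | step _ ih => exact ih.trans (hS _)
  refine ⟨fun n => (S (n + 1))[n]'(hlen (n + 1)), fun n => ?_⟩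
  refine List.ext_getElem (length_initSeg _ _) fun i h₁ h₂ => ?_
  simp only [initSeg, List.getElem_map, List.getElem_range]
  rcases le_total (i + 1) n with h | h
  · exact (hmono h).getElem _
  · exact ((hmono h).getElem _).symm

/-- `σ` is a stabilizing sequence for `T` on `L`. -/
def Stabilizes (T : List ℕ → ℕ) (L : Set ℕ) (σ : List ℕ) : Prop :=
  (∀ x ∈ σ, x ∈ L) ∧ ∀ τ : List ℕ, (∀ x ∈ τ, x ∈ L) → T (σ ++ τ) = T σ

theorem TxtExStarLearnsSet.exists_stabilizes {T : List ℕ → ℕ} {L : Set ℕ}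
    (hT : TxtExStarLearnsSet (fun ρ => Part.some (T ρ)) L) (hL : L.Nonempty) :
    ∃ σ, Stabilizes T L σ := by
  by_contra hno
  have hstep : ∀ σ : List ℕ, ∃ τ : List ℕ, (∀ x ∈ σ, x ∈ L) →
      (∀ x ∈ τ, x ∈ L) ∧ T (σ ++ τ) ≠ T σ := fun σ => by
    by_cases hσ : ∀ x ∈ σ, x ∈ L
    · by_contra! hc
      exact hno ⟨σ, hσ, fun τ hτ => by_contra fun hne => hne ((hc τ).2 hτ)⟩
    · exact ⟨[], fun h => absurd h hσ⟩
  choose g hg using hstep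
  obtain ⟨f, rfl⟩ := (Set.to_countable L).exists_eq_range hL
  let S : ℕ → List ℕ := fun n => Nat.rec [] (fun k σ => σ ++ g σ ++ [f k]) n
  have hS : ∀ n, S (n + 1) = S n ++ g (S n) ++ [f n] := fun n => rfl
  have hSL : ∀ n, ∀ x ∈ S n, x ∈ Set.range f := fun n => by
    induction n with
    | zero => simp [S]
    | succ n ih =>
      intro x hx
      rw [hS, List.mem_append, List.mem_append, List.mem_singleton] at hx
      rcases hx with (hx | hx) | rfl
      · exact ih x hx
      · exact (hg _ ih).1 x hx
      · exact ⟨n, rfl⟩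
  clear_value S
  have hlen : ∀ n, n ≤ (S n).length := fun n => by
    induction n with
    | zero => exact Nat.zero_le _
    | succ n ih =>
      rw [hS]
      simp only [List.length_append, List.length_singleton]
      omega
  obtain ⟨F, hF⟩ := exists_initSeg_eq (fun n => ⟨g (S n) ++ [f n], by simp [hS]⟩) hlen
  have hrange : Set.range F = Set.range f := by
    ext x
    constructor
    · rintro ⟨i, rfl⟩
      refine hSL (i + 1) _ ?_
      rw [← hF]
      exact mem_initSeg.2 ⟨i, hlen (i + 1), rfl⟩
    · rintro ⟨i, rfl⟩
      have : f i ∈ initSeg F (S (i + 1)).length := by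
        rw [hF, hS]
        simp
      obtain ⟨j, -, hj⟩ := mem_initSeg.1 this
      exact ⟨j, hj⟩
  obtain ⟨n, ⟨N, hN⟩, -⟩ := hT F hrange
  have h₁ : T (S N) = n := by
    have := hN _ (hlen N)
    rwa [hF, Part.some_inj] at this
  have h₂ : T (S N ++ g (S N)) = n := by
    have hle : (S N ++ g (S N)).length ≤ (S (N + 1)).length := by simp [hS]
    have := hN (S N ++ g (S N)).length
      ((hlen N).trans (by simp))
    rwa [← take_initSeg F hle, hF, hS, List.take_left, Part.some_inj] at this
  exact (hg _ (hSL N)).2 (h₂.trans h₁.symm)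

theorem TxtExStarLearnsSet.finite_symmDiff {T : List ℕ → ℕ} {L : Set ℕ}
    (hT : TxtExStarLearnsSet (fun ρ => Part.some (T ρ)) L) (hL : L.Nonempty)
    {σ : List ℕ} (hσ : Stabilizes T L σ) : (symmDiff (Wset (T σ)) L).Finite := by
  obtain ⟨f, rfl⟩ := (Set.to_countable L).exists_eq_range hL
  let S : ℕ → List ℕ := fun n => σ ++ initSeg f n
  have hmem : ∀ n, ∀ x ∈ initSeg f n, x ∈ Set.range f := fun n x hx =>
    let ⟨i, _, h⟩ := mem_initSeg.1 hx
    ⟨i, h⟩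
  have hlen : ∀ n, n ≤ (S n).length := fun n => by simp [S, length_initSeg]
  obtain ⟨F, hF⟩ := exists_initSeg_eq (S := S)
    (fun n => ⟨[f n], by simp [S, initSeg, List.range_succ]⟩) hlen
  have hrange : Set.range F = Set.range f := by
    ext x
    constructor
    · rintro ⟨i, rfl⟩
      have : F i ∈ S (i + 1) := by
        rw [← hF]
        exact mem_initSeg.2 ⟨i, hlen (i + 1), rfl⟩
      rcases List.mem_append.1 this with h | h
      · exact hσ.1 _ h
      · exact hmem _ _ h
    · rintro ⟨i, rfl⟩
      have : f i ∈ initSeg F (S (i + 1)).length := by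
        rw [hF]
        exact List.mem_append_right _ (mem_initSeg.2 ⟨i, i.lt_succ_self, rfl⟩)
      obtain ⟨j, -, hj⟩ := mem_initSeg.1 this
      exact ⟨j, hj⟩
  obtain ⟨n, ⟨N, hN⟩, hfin⟩ := hT F hrange
  have : T (S N) = n := by
    have := hN _ (hlen N)
    rwa [hF, Part.some_inj] at this
  rw [hσ.2 _ (hmem N)] at this
  rwa [this, ← hrange]

/-! ### A total learner from a partial one -/

open Nat.Partrec (Code)
open Nat.Partrec.Code (evaln evaln_mono evaln_sound evaln_complete)

/-- The last value that the `m`-th learner is seen to produce on a prefix of `ρ` within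
`ρ.length` steps. -/
def totalLearner (m : ℕ) (ρ : List ℕ) : ℕ :=
  Nat.rec 0 (fun j r => (evaln ρ.length (Denumerable.ofNat Code m)
    (Encodable.encode (ρ.take j))).getD r) (ρ.length + 1)

theorem primrec_totalLearner : Primrec₂ totalLearner := by
  have h : Primrec₂ fun (c : ℕ × List ℕ) (d : ℕ × ℕ) =>
      (evaln c.2.length (Denumerable.ofNat Code c.1)
        (Encodable.encode (c.2.take d.1))).getD d.2 := by
    have hρ : Primrec fun p : (ℕ × List ℕ) × ℕ × ℕ => p.1.2 := Primrec.snd.comp Primrec.fst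
    have hm : Primrec fun p : (ℕ × List ℕ) × ℕ × ℕ => p.1.1 := Primrec.fst.comp Primrec.fst
    exact Primrec.option_getD.comp
      (Nat.Partrec.Code.primrec_evaln.comp (Primrec.pair
        (Primrec.pair (Primrec.list_length.comp hρ) ((Primrec.ofNat Code).comp hm))
        (Primrec.encode.comp (Primrec.list_take.comp (Primrec.fst.comp Primrec.snd) hρ))))
      (Primrec.snd.comp Primrec.snd)
  exact Primrec.nat_rec' (Primrec.succ.comp (Primrec.list_length.comp Primrec.snd))
    (Primrec.const 0) h

theorem totalLearner_eventually_eq {m n : ℕ} {f : ℕ → ℕ} {N : ℕ}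
    (h : ∀ i ≥ N, learnerOfCode m (initSeg f i) = Part.some n) :
    ∃ N', ∀ i ≥ N', totalLearner m (initSeg f i) = n := by
  obtain ⟨s, hs⟩ := evaln_complete.1 (Part.eq_some_iff.1 (h N le_rfl))
  refine ⟨max s N, fun k hk => ?_⟩
  have key : ∀ j, N ≤ j → j ≤ k →
      Nat.rec (motive := fun _ => ℕ) 0 (fun j r => (evaln (initSeg f k).length
        (Denumerable.ofNat Code m)
        (Encodable.encode ((initSeg f k).take j))).getD r) (j + 1) = n := by
    intro j hj
    induction j, hj using Nat.le_induction with
    | base =>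
      intro hle
      have := evaln_mono (le_of_max_le_left hk) hs
      simp [length_initSeg, take_initSeg f hle, Option.mem_def.1 this]
    | succ j hj ih =>
      intro hle
      have ih := ih (by omega)
      simp only [length_initSeg, take_initSeg f hle] at ih ⊢
      cases he : evaln k (Denumerable.ofNat Code m) (Encodable.encode (initSeg f (j + 1))) with
      | none => exact ih
      | some v =>
        have h₁ := evaln_sound (Option.mem_def.2 he)
        have h₂ := Part.eq_some_iff.1 (h (j + 1) (by omega))
        exact Part.mem_unique h₁ h₂
  have := key k (le_of_max_le_right hk) le_rfl
  rw [totalLearner]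
  convert this using 2
  rw [length_initSeg]

theorem txtExStarLearnsSet_totalLearner {m : ℕ} {L : Set ℕ}
    (h : TxtExStarLearnsSet (learnerOfCode m) L) :
    TxtExStarLearnsSet (fun ρ => Part.some (totalLearner m ρ)) L := fun f hf => by
  obtain ⟨n, ⟨N, hN⟩, hfin⟩ := h f hf
  obtain ⟨N', hN'⟩ := totalLearner_eventually_eq hN
  exact ⟨n, ⟨N', fun i hi => congrArg Part.some (hN' i hi)⟩, hfin⟩

theorem exists_eq_learnerOfCode {M : List ℕ →. ℕ} (hM : Partrec M) :
    ∃ m, learnerOfCode m = M := by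
  obtain ⟨c, hc⟩ := Nat.Partrec.Code.exists_code.1 hM
  refine ⟨Encodable.encode c, funext fun σ => ?_⟩
  simp only [learnerOfCode, Denumerable.ofNat_encode, hc, Encodable.encodek, Part.coe_some,
    Part.bind_some]
  exact Part.map_id' (fun _ => rfl) _

/-! ### A learner from stabilizing sequences -/

/-- The list with code `k`. -/
def listOfCode (k : ℕ) : List ℕ := (Encodable.decode k : Option (List ℕ)).getD default

theorem primrec_listOfCode : Primrec listOfCode :=
  Primrec.option_getD_default.comp Primrec.decode

theorem listOfCode_encode (σ : List ℕ) : listOfCode (Encodable.encode σ) = σ := by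
  simp [listOfCode]

/-- The list with code `k` looks like a stabilizing sequence for `T`, as far as this can be
seen from the data `ρ`. -/
def SeemsStabilizing (T : List ℕ → ℕ) (ρ : List ℕ) (k : ℕ) : Prop :=
  (∀ x ∈ listOfCode k, x ∈ ρ) ∧ ∀ j < ρ.length, (∀ x ∈ listOfCode j, x ∈ ρ) →
    T (listOfCode k ++ listOfCode j) = T (listOfCode k)

theorem primrecRel_subset : PrimrecRel fun σ ρ : List ℕ => ∀ x ∈ σ, x ∈ ρ := by
  have hmem : PrimrecRel fun (x : ℕ) (ρ : List ℕ) => x ∈ ρ :=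
    ((Primrec.eq (α := ℕ)).exists_mem_list.comp Primrec.snd Primrec.fst).of_eq fun p => by simp
  exact hmem.forall_mem_list

theorem primrecRel_seemsStabilizing {T : List ℕ → ℕ} (hT : Primrec T) :
    PrimrecRel (SeemsStabilizing T) := by
  have hsub : PrimrecRel fun (k : ℕ) (ρ : List ℕ) => ∀ x ∈ listOfCode k, x ∈ ρ :=
    primrecRel_subset.comp (primrec_listOfCode.comp Primrec.fst) Primrec.snd
  have hρ : Primrec fun p : ℕ × List ℕ × ℕ => p.2.1 := Primrec.fst.comp Primrec.snd
  have hk : Primrec fun p : ℕ × List ℕ × ℕ => listOfCode p.2.2 :=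
    primrec_listOfCode.comp (Primrec.snd.comp Primrec.snd)
  have hj : Primrec fun p : ℕ × List ℕ × ℕ => listOfCode p.1 :=
    primrec_listOfCode.comp Primrec.fst
  have hbody : PrimrecRel fun (j : ℕ) (p : List ℕ × ℕ) => ¬ (∀ x ∈ listOfCode j, x ∈ p.1) ∨
      T (listOfCode p.2 ++ listOfCode j) = T (listOfCode p.2) :=
    PrimrecPred.or (PrimrecPred.not (hsub.comp Primrec.fst hρ))
      (Primrec.eq.comp (hT.comp (Primrec.list_append.comp hk hj)) (hT.comp hk))
  have hall : PrimrecPred fun p : List ℕ × ℕ => ∀ j ∈ List.range p.1.length,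
      ¬ (∀ x ∈ listOfCode j, x ∈ p.1) ∨
        T (listOfCode p.2 ++ listOfCode j) = T (listOfCode p.2) :=
    hbody.forall_mem_list.comp
      (Primrec.list_range.comp (Primrec.list_length.comp Primrec.fst)) Primrec.id
  refine PrimrecPred.of_eq (PrimrecPred.and (hsub.comp Primrec.snd Primrec.fst) hall) fun p => ?_
  simp only [SeemsStabilizing, List.mem_range, imp_iff_not_or]

open Classical in
/-- The learner that conjectures `T σ` for the first `σ` that looks like a stabilizing
sequence. -/
noncomputable def stabilizingLearner (T : List ℕ → ℕ) : List ℕ →. ℕ := fun ρ =>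
  (Nat.rfind fun k => Part.some (decide (SeemsStabilizing T ρ k))).map fun k => T (listOfCode k)

theorem partrec_stabilizingLearner {T : List ℕ → ℕ} (hT : Primrec T) :
    Partrec (stabilizingLearner T) := by
  classical
  refine Partrec.map (Partrec.rfind (Computable.partrec ?_))
    ((hT.comp (primrec_listOfCode.comp Primrec.snd)).to_comp)
  exact (ComputablePred.decide (primrecRel_seemsStabilizing hT).computablePred)

theorem txtExStarLearnsSet_stabilizingLearner {T : List ℕ → ℕ} {L : Set ℕ}
    (hex : ∃ σ, Stabilizes T L σ)
    (hfin : ∀ σ, Stabilizes T L σ → (symmDiff (Wset (T σ)) L).Finite) :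
    TxtExStarLearnsSet (stabilizingLearner T) L := by
  classical
  rintro f rfl
  have hex' : ∃ k, Stabilizes T (Set.range f) (listOfCode k) := by
    obtain ⟨σ, hσ⟩ := hex
    exact ⟨Encodable.encode σ, by rwa [listOfCode_encode]⟩
  let k := Nat.find hex'
  have hk : Stabilizes T (Set.range f) (listOfCode k) := Nat.find_spec hex'
  have hrange : ∀ {i : ℕ} {σ : List ℕ}, (∀ x ∈ σ, x ∈ initSeg f i) →
      ∀ x ∈ σ, x ∈ Set.range f := fun h x hx =>
    let ⟨j, _, hj⟩ := mem_initSeg.1 (h x hx)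
    ⟨j, hj⟩
  have hlt : ∀ l ∈ Finset.range k, ∀ᶠ i in atTop, ¬ SeemsStabilizing T (initSeg f i) l := by
    intro l hl
    have hns := Nat.find_min hex' (Finset.mem_range.1 hl)
    by_cases hsub : ∀ x ∈ listOfCode l, x ∈ Set.range f
    · have : ∃ τ : List ℕ, (∀ x ∈ τ, x ∈ Set.range f) ∧
          T (listOfCode l ++ τ) ≠ T (listOfCode l) := by
        by_contra! hc
        exact hns ⟨hsub, hc⟩
      obtain ⟨τ, hτ, hne⟩ := this
      filter_upwards [eventually_subset_initSeg hτ,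
        eventually_gt_atTop (Encodable.encode τ)] with i hi hgt hs
      have := hs.2 (Encodable.encode τ) (by rwa [length_initSeg])
      rw [listOfCode_encode] at this
      exact hne (this hi)
    · exact Eventually.of_forall fun i hs => hsub (hrange hs.1)
  have hev : ∀ᶠ i in atTop, stabilizingLearner T (initSeg f i) =
      Part.some (T (listOfCode k)) := by
    filter_upwards [(eventually_all_finset _).2 hlt, eventually_subset_initSeg hk.1]
      with i hi hsub
    have : k ∈ Nat.rfind fun k => Part.some (decide (SeemsStabilizing T (initSeg f i) k)) := by
      refine Nat.mem_rfind.2 ⟨?_, fun {l} hl => ?_⟩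
      · have : SeemsStabilizing T (initSeg f i) k :=
          ⟨hsub, fun j _ hj => hk.2 _ (hrange hj)⟩
        simp [this]
      · simp [hi l (Finset.mem_range.2 hl)]
    exact Part.eq_some_iff.2 (Part.mem_map _ this)
  obtain ⟨N, hN⟩ := eventually_atTop.1 hev
  exact ⟨_, ⟨N, hN⟩, hfin _ hk⟩

/-! ### The index set -/

theorem mem_EXLstar_iff (e : ℕ) : e ∈ EXLstar ↔ ∃ m, ∀ i a : ℕ, ∀ σ : List ℕ,
    ¬ a ∈ column e i ∨ ((∃ τ, Stabilizes (totalLearner m) (column e i) τ) ∧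
      (¬ Stabilizes (totalLearner m) (column e i) σ ∨
        (symmDiff (Wset (totalLearner m σ)) (column e i)).Finite)) := by
  constructor
  · rintro ⟨M, hM, h⟩
    obtain ⟨m, rfl⟩ := exists_eq_learnerOfCode hM
    refine ⟨m, fun i a σ => or_iff_not_imp_left.2 fun ha => ?_⟩
    have hne : (column e i).Nonempty := ⟨a, not_not.1 ha⟩
    exact ⟨(txtExStarLearnsSet_totalLearner (h i)).exists_stabilizes hne, or_iff_not_imp_left.2 fun hσ =>
      (txtExStarLearnsSet_totalLearner (h i)).finite_symmDiff hne (not_not.1 hσ)⟩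
  · rintro ⟨m, h⟩
    refine ⟨stabilizingLearner (totalLearner m), partrec_stabilizingLearner
      (primrec_totalLearner.comp (Primrec.const m) Primrec.id), fun i f hf => ?_⟩
    have h' := fun σ => (h i (f 0) σ).resolve_left (by simp [← hf])
    exact txtExStarLearnsSet_stabilizingLearner (h' []).1
      (fun σ hσ => (h' σ).2.resolve_left (not_not.2 hσ)) f hf

theorem mem_Wset_iff {e x : ℕ} :
    x ∈ Wset e ↔ ∃ s, (evaln s (Denumerable.ofNat Code e) x).isSome := by
  simp only [Wset, Set.mem_ofPred_eq, Part.dom_iff_mem, evaln_complete, Option.isSome_iff_exists,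
    Option.mem_def]
  exact exists_comm

theorem primrecPred_evaln_isSome : PrimrecPred fun p : (ℕ × ℕ) × ℕ =>
    (evaln p.2 (Denumerable.ofNat Code p.1.1) p.1.2).isSome = true :=
  Primrec.eq.comp (Primrec.option_isSome.comp (Nat.Partrec.Code.primrec_evaln.comp
    (Primrec.pair (Primrec.pair Primrec.snd ((Primrec.ofNat Code).comp
      (Primrec.fst.comp Primrec.fst))) (Primrec.snd.comp Primrec.fst)))) (Primrec.const true)

theorem sigmaPred_mem_Wset : SigmaPred 1 fun p : ℕ × ℕ => p.2 ∈ Wset p.1 :=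
  ⟨fun p => (evaln p.2 (Denumerable.ofNat Code p.1.1) p.1.2).isSome = true,
    PrimrecPred.not primrecPred_evaln_isSome, fun _ => mem_Wset_iff⟩

theorem sigmaPred_mem_column : SigmaPred 1 fun p : (ℕ × ℕ) × ℕ => p.2 ∈ column p.1.1 p.1.2 :=
  sigmaPred_mem_Wset.comp (f := fun p : (ℕ × ℕ) × ℕ => (p.1.1, Nat.pair p.1.2 p.2))
    (Primrec.pair (Primrec.fst.comp Primrec.fst)
      (Primrec₂.natPair.comp (Primrec.snd.comp Primrec.fst) Primrec.snd))

theorem subset_column_iff {e i : ℕ} {σ : List ℕ} : (∀ x ∈ σ, x ∈ column e i) ↔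
    ∃ s, ∀ x ∈ σ, (evaln s (Denumerable.ofNat Code e) (Nat.pair i x)).isSome = true := by
  constructor
  · intro h
    have := (eventually_all_finset (l := atTop) σ.toFinset (p := fun x s =>
      (evaln s (Denumerable.ofNat Code e) (Nat.pair i x)).isSome = true)).2 fun x hx => by
        obtain ⟨s, hs⟩ := mem_Wset_iff.1 (h x (List.mem_toFinset.1 hx))
        obtain ⟨v, hv⟩ := Option.isSome_iff_exists.1 hs
        filter_upwards [eventually_ge_atTop s] with t ht
        exact Option.isSome_iff_exists.2 ⟨v, evaln_mono ht hv⟩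
    obtain ⟨s, hs⟩ := this.exists
    exact ⟨s, fun x hx => hs x (List.mem_toFinset.2 hx)⟩
  · rintro ⟨s, hs⟩ x hx
    exact mem_Wset_iff.2 ⟨s, hs x hx⟩

theorem sigmaPred_subset_column :
    SigmaPred 1 fun p : (ℕ × ℕ) × List ℕ => ∀ x ∈ p.2, x ∈ column p.1.1 p.1.2 := by
  have hrel : PrimrecRel fun (x : ℕ) (p : (ℕ × ℕ) × ℕ) =>
      (evaln p.2 (Denumerable.ofNat Code p.1.1) (Nat.pair p.1.2 x)).isSome = true := by
    have h₁ : Primrec fun q : ℕ × (ℕ × ℕ) × ℕ => q.2.1.1 :=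
      Primrec.fst.comp (Primrec.fst.comp Primrec.snd)
    have h₂ : Primrec fun q : ℕ × (ℕ × ℕ) × ℕ => q.2.1.2 :=
      Primrec.snd.comp (Primrec.fst.comp Primrec.snd)
    exact PrimrecPred.comp primrecPred_evaln_isSome (Primrec.pair (Primrec.pair h₁
      (Primrec₂.natPair.comp h₂ Primrec.fst)) (Primrec.snd.comp Primrec.snd))
  exact ⟨fun c => ∀ x ∈ c.1.2,
      (evaln c.2 (Denumerable.ofNat Code c.1.1.1) (Nat.pair c.1.1.2 x)).isSome = true,
    PrimrecPred.not (hrel.forall_mem_list.comp (Primrec.snd.comp Primrec.fst)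
      (Primrec.pair (Primrec.fst.comp Primrec.fst) Primrec.snd)),
    fun _ => subset_column_iff⟩

theorem sigmaPred_stabilizes : SigmaPred 2 (fun p : (ℕ × ℕ × ℕ) × List ℕ =>
      Stabilizes (totalLearner p.1.1) (column p.1.2.1 p.1.2.2) p.2) ∧
    SigmaPred 2 (fun p : (ℕ × ℕ × ℕ) × List ℕ =>
      ¬ Stabilizes (totalLearner p.1.1) (column p.1.2.1 p.1.2.2) p.2) := by
  have hsub : SigmaPred 1 fun p : (ℕ × ℕ × ℕ) × List ℕ =>
      ∀ x ∈ p.2, x ∈ column p.1.2.1 p.1.2.2 :=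
    sigmaPred_subset_column.comp
      (f := fun p : (ℕ × ℕ × ℕ) × List ℕ => ((p.1.2.1, p.1.2.2), p.2))
      (Primrec.pair (Primrec.snd.comp Primrec.fst) Primrec.snd)
  have hchange : SigmaPred 1 fun p : (ℕ × ℕ × ℕ) × List ℕ => ∃ τ : List ℕ,
      (∀ x ∈ τ, x ∈ column p.1.2.1 p.1.2.2) ∧
        ¬ totalLearner p.1.1 (p.2 ++ τ) = totalLearner p.1.1 p.2 := by
    refine SigmaPred.exists' (SigmaPred.and ?_ (SigmaPred.succ (n := 0) ?_))
    · exact hsub.comp (f := fun c : ((ℕ × ℕ × ℕ) × List ℕ) × List ℕ => (c.1.1, c.2))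
        (Primrec.pair (Primrec.fst.comp Primrec.fst) Primrec.snd)
    · have hm : Primrec fun c : ((ℕ × ℕ × ℕ) × List ℕ) × List ℕ => c.1.1.1 :=
        Primrec.fst.comp (Primrec.fst.comp Primrec.fst)
      have hσ : Primrec fun c : ((ℕ × ℕ × ℕ) × List ℕ) × List ℕ => c.1.2 :=
        Primrec.snd.comp Primrec.fst
      exact PrimrecPred.not (Primrec.eq.comp
        (primrec_totalLearner.comp hm (Primrec.list_append.comp hσ Primrec.snd))
        (primrec_totalLearner.comp hm hσ))
  constructor
  · refine (hsub.succ.and hchange.not_succ).of_iff fun p => ?_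
    simp [Stabilizes]
  · refine (hsub.not_succ.or hchange.succ).of_iff fun p => ?_
    simp only [Stabilizes, not_and_or, not_forall, exists_prop]

theorem finite_iff_exists_bound {A : Set ℕ} : A.Finite ↔ ∃ b, ∀ x, x < b ∨ x ∉ A := by
  constructor
  · intro h
    obtain ⟨b, hb⟩ := h.bddAbove
    exact ⟨b + 1, fun x => or_iff_not_imp_right.2 fun hx =>
      Nat.lt_succ_of_le (hb (not_not.1 hx))⟩
  · rintro ⟨b, hb⟩
    exact (Set.finite_lt_nat b).subset fun x hx => (hb x).resolve_right (not_not.2 hx)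

theorem sigmaPred_finite_symmDiff : SigmaPred 3 fun p : (ℕ × ℕ × ℕ) × List ℕ =>
    (symmDiff (Wset (totalLearner p.1.1 p.2)) (column p.1.2.1 p.1.2.2)).Finite := by
  have hW : SigmaPred 1 fun c : (((ℕ × ℕ × ℕ) × List ℕ) × ℕ) × ℕ =>
      c.2 ∈ Wset (totalLearner c.1.1.1.1 c.1.1.2) :=
    sigmaPred_mem_Wset.comp (Primrec.pair (primrec_totalLearner.comp
      (Primrec.fst.comp (Primrec.fst.comp (Primrec.fst.comp Primrec.fst)))
      (Primrec.snd.comp (Primrec.fst.comp Primrec.fst))) Primrec.snd)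
  have hL : SigmaPred 1 fun c : (((ℕ × ℕ × ℕ) × List ℕ) × ℕ) × ℕ =>
      c.2 ∈ column c.1.1.1.2.1 c.1.1.1.2.2 :=
    sigmaPred_mem_column.comp (f := fun c : (((ℕ × ℕ × ℕ) × List ℕ) × ℕ) × ℕ =>
      ((c.1.1.1.2.1, c.1.1.1.2.2), c.2)) (Primrec.pair
        (Primrec.snd.comp (Primrec.fst.comp (Primrec.fst.comp Primrec.fst))) Primrec.snd)
  have hbad : SigmaPred 2 fun c : (((ℕ × ℕ × ℕ) × List ℕ) × ℕ) × ℕ => ¬ (c.2 < c.1.2 ∨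
      c.2 ∉ symmDiff (Wset (totalLearner c.1.1.1.1 c.1.1.2))
        (column c.1.1.1.2.1 c.1.1.1.2.2)) := by
    have hlt : SigmaPred 0 fun c : (((ℕ × ℕ × ℕ) × List ℕ) × ℕ) × ℕ => ¬ c.2 < c.1.2 :=
      PrimrecPred.not (Primrec.nat_lt.comp Primrec.snd (Primrec.snd.comp Primrec.fst))
    refine (hlt.succ.succ.and ((hW.succ.and hL.not_succ).or (hL.succ.and hW.not_succ))).of_iff
      fun c => ?_
    rw [not_or, not_not, Set.mem_symmDiff]
  have hex : SigmaPred 2 fun c : ((ℕ × ℕ × ℕ) × List ℕ) × ℕ => ¬ ∀ x, x < c.2 ∨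
      x ∉ symmDiff (Wset (totalLearner c.1.1.1 c.1.2)) (column c.1.1.2.1 c.1.1.2.2) :=
    hbad.exists_nat.of_iff fun _ => not_forall.symm
  exact ⟨_, hex, fun p => finite_iff_exists_bound⟩

/-- The matrix of the definition of EXL*, after the quantifiers over the learner `m`, the index
`i`, the element `a` and the sequence `σ`. -/
def LearnsStably (e m i a : ℕ) (σ : List ℕ) : Prop :=
  a ∉ column e i ∨ ((∃ τ, Stabilizes (totalLearner m) (column e i) τ) ∧
    (¬ Stabilizes (totalLearner m) (column e i) σ ∨
      (symmDiff (Wset (totalLearner m σ)) (column e i)).Finite))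

theorem sigmaPred_learnsStably : SigmaPred 3 fun c : (ℕ × ℕ) × (ℕ × ℕ) × List ℕ =>
    LearnsStably c.1.1 c.1.2 c.2.1.1 c.2.1.2 c.2.2 := by
  have hreorder : Primrec fun c : (ℕ × ℕ) × (ℕ × ℕ) × List ℕ => (c.1.2, c.1.1, c.2.1.1) :=
    Primrec.pair (Primrec.snd.comp Primrec.fst) (Primrec.pair (Primrec.fst.comp Primrec.fst)
      (Primrec.fst.comp (Primrec.fst.comp Primrec.snd)))
  have hreorder' : Primrec fun c : (ℕ × ℕ) × (ℕ × ℕ) × List ℕ =>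
      ((c.1.2, c.1.1, c.2.1.1), c.2.2) :=
    Primrec.pair hreorder (Primrec.snd.comp Primrec.snd)
  have hmem : SigmaPred 1 fun c : (ℕ × ℕ) × (ℕ × ℕ) × List ℕ =>
      c.2.1.2 ∈ column c.1.1 c.2.1.1 :=
    sigmaPred_mem_column.comp (f := fun c : (ℕ × ℕ) × (ℕ × ℕ) × List ℕ =>
      ((c.1.1, c.2.1.1), c.2.1.2)) (Primrec.pair (Primrec.snd.comp hreorder)
        (Primrec.snd.comp (Primrec.fst.comp Primrec.snd)))
  have hex : SigmaPred 3 fun q : ℕ × ℕ × ℕ =>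
      ∃ τ, Stabilizes (totalLearner q.1) (column q.2.1 q.2.2) τ :=
    SigmaPred.exists' (p := fun (q : ℕ × ℕ × ℕ) τ =>
      Stabilizes (totalLearner q.1) (column q.2.1 q.2.2) τ) sigmaPred_stabilizes.1.succ
  have hlearns := (hex.comp hreorder).and ((sigmaPred_stabilizes.2.succ.comp hreorder').or
    (sigmaPred_finite_symmDiff.comp hreorder'))
  exact (hmem.not_succ.succ.or hlearns).of_iff fun _ => Iff.rfl

/-- EXL* is a Σ⁰₅ set. -/
theorem EXLstar_isSigma5 : IsSigma5 EXLstar := by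
  have h : SigmaPred 5 fun e : ℕ => ∃ m, ∀ d : (ℕ × ℕ) × List ℕ,
      LearnsStably e m d.1.1 d.1.2 d.2 :=
    ⟨fun c => ∀ d : (ℕ × ℕ) × List ℕ, LearnsStably c.1 c.2 d.1.1 d.1.2 d.2,
      SigmaPred.not_forall' (p := fun (c : ℕ × ℕ) (d : (ℕ × ℕ) × List ℕ) =>
        LearnsStably c.1 c.2 d.1.1 d.1.2 d.2) sigmaPred_learnsStably, fun _ => Iff.rfl⟩
  refine (h.of_iff fun e => ?_).isSigma5
  rw [mem_EXLstar_iff]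
  simp only [Prod.forall, LearnsStably]
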